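/- arXiv:1304.2809 — 3 statements merged into one kernel-verified Lean document; each statement's English description precedes it below -/
import Mathlib

section
/- Let A ∈ ℝ^{k×N} with 2s < k. If the RIP constant δ_{2s} of A of order 2s satisfies δ_{2s} < √2 − 1, then for every s-sparse vector x̄ ∈ ℝ^N, the problem of minimizing ‖x‖₁ subject to Ax = Ax̄ has a unique solution, and this solution is x = x̄. -/
open scoped BigOperators

/-- The ℓ¹ norm of a finitely-indexed real vector. -/
noncomputable def l1norm {ι : Type*} [Fintype ι] (x : ι → ℝ) : ℝ := ∑ i, |x i|

/-- The Euclidean (ℓ²) norm of a finitely-indexed real vector. -/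
noncomputable def l2norm {ι : Type*} [Fintype ι] (x : ι → ℝ) : ℝ :=
  Real.sqrt (∑ i, (x i) ^ 2)

/-- The squared Euclidean norm of a finitely-indexed real vector. -/
noncomputable def l2sq {ι : Type*} [Fintype ι] (x : ι → ℝ) : ℝ := ∑ i, (x i) ^ 2

/-- `x` is `s`-sparse: at most `s` of its components are nonzero. -/
def IsSparse {ι : Type*} (s : ℕ) (x : ι → ℝ) : Prop :=
  ∃ S : Finset ι, S.card ≤ s ∧ ∀ i ∉ S, x i = 0

/-- The restriction `x_S` of a vector `x` to an index set `S` (zero outside `S`). -/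
def restrictVec {ι : Type*} [DecidableEq ι] (S : Finset ι) (x : ι → ℝ) : ι → ℝ :=
  fun i => if i ∈ S then x i else 0

/-- `A` satisfies the Null Space Property of order `s`. -/
def NSP {κ ι : Type*} [Fintype κ] [Fintype ι] [DecidableEq ι]
    (A : Matrix κ ι ℝ) (s : ℕ) : Prop :=
  ∀ v : ι → ℝ, A.mulVec v = 0 → v ≠ 0 →
    ∀ S : Finset ι, S.card = s → l1norm (restrictVec S v) < (1 / 2) * l1norm v

/-- `A` satisfies the Restricted Isometry Property of order `s` with constant `δ`. -/
def RIPwith {κ ι : Type*} [Fintype κ] [Fintype ι] (A : Matrix κ ι ℝ) (s : ℕ) (δ : ℝ) : Prop :=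
  ∀ x : ι → ℝ, IsSparse s x →
    (1 - δ) * l2sq x ≤ l2sq (A.mulVec x) ∧ l2sq (A.mulVec x) ≤ (1 + δ) * l2sq x

/-- `A = (A1, A2)` satisfies the Null Space Property of order `t` for partially
sparse recovery (the part with matrix `A1` is the sparse part). -/
def PartialNSP {k m r : ℕ} (A1 : Matrix (Fin k) (Fin m) ℝ) (A2 : Matrix (Fin k) (Fin r) ℝ)
    (t : ℕ) : Prop :=
  (∀ x2 : Fin r → ℝ, A2.mulVec x2 = 0 → x2 = 0) ∧
  ∀ v1 : Fin m → ℝ, v1 ≠ 0 → (∃ v2 : Fin r → ℝ, A1.mulVec v1 = A2.mulVec v2) →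
    ∀ S : Finset (Fin m), S.card = t →
      l1norm (restrictVec S v1) < (1 / 2) * l1norm v1

/-- `P = I - A2 (A2ᵀ A2)⁻¹ A2ᵀ`, the orthogonal projection onto the orthogonal
complement of the column space of `A2` (when `A2` has full column rank). -/
noncomputable def projPerp {k r : ℕ} (A2 : Matrix (Fin k) (Fin r) ℝ) :
    Matrix (Fin k) (Fin k) ℝ :=
  1 - A2 * (A2.transpose * A2)⁻¹ * A2.transpose

/-- `σ_s(x)₁`, the best `s`-term approximation error of `x` in the ℓ¹ norm. -/
noncomputable def sigma1 {ι : Type*} [Fintype ι] (s : ℕ) (x : ι → ℝ) : ℝ :=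
  sInf {t | ∃ z : ι → ℝ, IsSparse s z ∧ t = l1norm (z - x)}

/-- The operator norm of a matrix induced by the Euclidean vector norms. -/
noncomputable def opNorm2 {a b : ℕ} (M : Matrix (Fin a) (Fin b) ℝ) : ℝ :=
  sSup {t | ∃ x : Fin b → ℝ, l2norm x ≤ 1 ∧ t = l2norm (M.mulVec x)}

lemma isSparse_restrictVec {ι : Type*} [DecidableEq ι] {n : ℕ} {S : Finset ι} (hS : S.card ≤ n)
    (x : ι → ℝ) : IsSparse n (restrictVec S x) :=
  ⟨S, hS, fun i hi => by simp [restrictVec, hi]⟩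

lemma l2sq_restrictVec {ι : Type*} [Fintype ι] [DecidableEq ι] (S : Finset ι) (x : ι → ℝ) :
    l2sq (restrictVec S x) = ∑ i ∈ S, x i ^ 2 := by
  simp [l2sq, restrictVec, ite_pow]

lemma restrictVec_union {ι : Type*} [DecidableEq ι] {S T : Finset ι} (h : Disjoint S T)
    (x : ι → ℝ) : restrictVec (S ∪ T) x = restrictVec S x + restrictVec T x := by
  ext i
  by_cases hS : i ∈ S
  · simp [restrictVec, hS, Finset.disjoint_left.mp h hS]
  · simp [restrictVec, hS]

lemma sq_sum_abs_le {ι : Type*} (S : Finset ι) {s : ℕ} (hS : S.card ≤ s) (x : ι → ℝ) :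
    (∑ i ∈ S, |x i|) ^ 2 ≤ s * ∑ i ∈ S, x i ^ 2 := by
  calc (∑ i ∈ S, |x i|) ^ 2 ≤ S.card * ∑ i ∈ S, |x i| ^ 2 := sq_sum_le_card_mul_sum_sq
    _ ≤ s * ∑ i ∈ S, x i ^ 2 := by
      simp only [sq_abs]
      gcongr

lemma l2sq_eq_dotProduct {κ : Type*} [Fintype κ] (v : κ → ℝ) : l2sq v = v ⬝ᵥ v := by
  simp [l2sq, dotProduct, sq]

/-- Restricted isometries almost preserve orthogonality of vectors with disjoint supports. -/
lemma RIPwith.abs_dotProduct_le {κ ι : Type*} [Fintype κ] [Fintype ι] [DecidableEq ι]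
    {A : Matrix κ ι ℝ} {s : ℕ} {δ : ℝ} (hδ : 0 ≤ δ) (hA : RIPwith A (2 * s) δ)
    {S T : Finset ι} (hS : S.card ≤ s) (hT : T.card ≤ s) (hST : Disjoint S T) (x : ι → ℝ) :
    |A.mulVec (restrictVec S x) ⬝ᵥ A.mulVec (restrictVec T x)| ≤
      δ * √(∑ i ∈ S, x i ^ 2) * √(∑ i ∈ T, x i ^ 2) := by
  set a := restrictVec S x with ha
  set b := restrictVec T x with hb
  have hcard : (S ∪ T).card ≤ 2 * s := (Finset.card_union_le S T).trans (by omega)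
  have horth : a ⬝ᵥ b = 0 := by
    refine Finset.sum_eq_zero fun i _ => ?_
    by_cases hi : i ∈ S
    · simp [ha, hb, restrictVec, Finset.disjoint_left.mp hST hi]
    · simp [ha, restrictVec, hi]
  have hsparse (t : ℝ) : IsSparse (2 * s) (a + t • b) := by
    refine ⟨S ∪ T, hcard, fun i hi => ?_⟩
    rw [Finset.mem_union, not_or] at hi
    simp [ha, hb, restrictVec, hi.1, hi.2]
  have hnorm (t : ℝ) : l2sq (a + t • b) = l2sq a + t ^ 2 * l2sq b := by
    simp only [l2sq_eq_dotProduct, add_dotProduct, dotProduct_add, smul_dotProduct,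
      dotProduct_smul, smul_eq_mul, dotProduct_comm b a, horth]
    ring
  have himage (t : ℝ) : l2sq (A.mulVec (a + t • b)) = l2sq (A.mulVec a) +
      2 * t * (A.mulVec a ⬝ᵥ A.mulVec b) + t ^ 2 * l2sq (A.mulVec b) := by
    simp only [l2sq_eq_dotProduct, Matrix.mulVec_add, Matrix.mulVec_smul, add_dotProduct,
      dotProduct_add, smul_dotProduct, dotProduct_smul, smul_eq_mul,
      dotProduct_comm (A.mulVec b) (A.mulVec a)]
    ring
  set c := A.mulVec a ⬝ᵥ A.mulVec b
  have hdisc := discrim_le_zero (a := δ * l2sq b) (b := 2 * c) (c := δ * l2sq a) fun t => by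
    have hlower := (hA _ (hsparse t)).1
    have hupper := (hA _ (hsparse (-t))).2
    rw [hnorm, himage] at hlower hupper
    nlinarith
  rw [ha, hb, l2sq_restrictVec, l2sq_restrictVec, discrim] at hdisc
  refine abs_le_of_sq_le_sq ?_ (by positivity)
  rw [mul_pow, mul_pow, Real.sq_sqrt (by positivity), Real.sq_sqrt (by positivity)]
  linarith

/-- A set `P` of at most `s` largest entries of `x` on `T`, separated from the rest by `m`. -/
lemma exists_largest_entries {ι : Type*} [DecidableEq ι] (x : ι → ℝ) (s : ℕ) (T : Finset ι) :
    ∃ P ⊆ T, P.card ≤ s ∧ (0 < s → T.Nonempty → P.Nonempty) ∧ ∃ m : ℝ, 0 ≤ m ∧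
      s * m ≤ ∑ i ∈ P, |x i| ∧ ∀ i ∈ T \ P, |x i| ≤ m := by
  rcases le_or_gt T.card s with hT | hT
  · refine ⟨T, subset_rfl, hT, fun _ h => h, 0, le_rfl, ?_, by simp⟩
    rw [mul_zero]
    positivity
  suffices H : ∀ n ≤ T.card, ∃ P ⊆ T, P.card = n ∧ ∃ m : ℝ, 0 ≤ m ∧
      (∀ i ∈ P, m ≤ |x i|) ∧ ∀ i ∈ T \ P, |x i| ≤ m by
    obtain ⟨P, hPT, hP, m, hm, hmP, hmT⟩ := H s hT.le
    refine ⟨P, hPT, hP.le, fun hs _ => Finset.card_pos.mp (hP ▸ hs), m, hm, ?_, hmT⟩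
    simpa [hP] using Finset.card_nsmul_le_sum P (fun i => |x i|) m hmP
  intro n
  induction n with
  | zero =>
    intro _
    refine ⟨∅, by simp, rfl, ∑ i ∈ T, |x i|, by positivity, by simp, fun i hi => ?_⟩
    exact Finset.single_le_sum (f := fun i => |x i|) (fun i _ => abs_nonneg _)
      (Finset.sdiff_subset hi)
  | succ n ih =>
    intro hn
    obtain ⟨P, hPT, hP, m, hm, hmP, hmT⟩ := ih (by omega)
    have hne : (T \ P).Nonempty := by
      rw [← Finset.card_pos, Finset.card_sdiff_of_subset hPT]
      omega
    obtain ⟨j, hj, hjmax⟩ := Finset.exists_max_image (T \ P) (fun i => |x i|) hne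
    have hj' := Finset.mem_sdiff.mp hj
    refine ⟨insert j P, Finset.insert_subset hj'.1 hPT, by simp [hj'.2, hP], |x j|,
      abs_nonneg _, fun i hi => ?_, fun i hi => hjmax i ?_⟩
    · rcases Finset.mem_insert.mp hi with rfl | hi
      · exact le_rfl
      · exact (hmT j hj).trans (hmP i hi)
    · simp only [Finset.mem_sdiff, Finset.mem_insert, not_or] at hi ⊢
      exact ⟨hi.1, hi.2.2⟩

/-- Summing the almost-orthogonality estimate over blocks of decreasing entries. -/
lemma RIPwith.sqrt_mul_abs_dotProduct_le {κ ι : Type*} [Fintype κ] [Fintype ι] [DecidableEq ι]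
    {A : Matrix κ ι ℝ} {s : ℕ} {δ : ℝ} (hs : 0 < s) (hδ : 0 ≤ δ) (hA : RIPwith A (2 * s) δ)
    (x : ι → ℝ) {S : Finset ι} (hS : S.card ≤ s) (T : Finset ι) (hST : Disjoint S T)
    {M : ℝ} (hM : 0 ≤ M) (hMT : ∀ i ∈ T, |x i| ≤ M) :
    √s * |A.mulVec (restrictVec S x) ⬝ᵥ A.mulVec (restrictVec T x)| ≤
      δ * √(∑ i ∈ S, x i ^ 2) * (s * M + ∑ i ∈ T, |x i|) := by
  induction T using Finset.strongInduction generalizing M with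
  | H T ih =>
    rcases T.eq_empty_or_nonempty with rfl | hT
    · have hzero : restrictVec ∅ x = 0 := by ext; simp [restrictVec]
      rw [hzero, Matrix.mulVec_zero, dotProduct_zero, abs_zero, mul_zero]
      positivity
    obtain ⟨P, hPT, hP, hPne, m, hm, hmP, hmT⟩ := exists_largest_entries x s T
    have hrest := ih (T \ P) (Finset.sdiff_ssubset hPT (hPne hs hT))
      (hST.mono_right Finset.sdiff_subset) hm hmT
    have hblock := hA.abs_dotProduct_le hδ hS hP (hST.mono_right hPT) x
    have hnormP : √s * √(∑ i ∈ P, x i ^ 2) ≤ s * M := by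
      rw [← Real.sqrt_mul (by positivity)]
      refine Real.sqrt_le_iff.mpr ⟨by positivity, ?_⟩
      have hsum : ∑ i ∈ P, x i ^ 2 ≤ s * M ^ 2 := by
        calc ∑ i ∈ P, x i ^ 2 ≤ P.card • M ^ 2 :=
              Finset.sum_le_card_nsmul _ _ _ fun i hi => sq_le_sq.mpr (by
                rw [abs_of_nonneg hM]
                exact hMT i (hPT hi))
          _ ≤ s * M ^ 2 := by
            rw [nsmul_eq_mul]
            gcongr
      calc s * ∑ i ∈ P, x i ^ 2 ≤ s * (s * M ^ 2) := by gcongr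
        _ = (s * M) ^ 2 := by ring
    have hsplit : restrictVec T x = restrictVec P x + restrictVec (T \ P) x := by
      rw [← restrictVec_union Finset.disjoint_sdiff, Finset.union_sdiff_of_subset hPT]
    rw [hsplit, Matrix.mulVec_add, dotProduct_add, ← Finset.sum_sdiff hPT]
    set p := A.mulVec (restrictVec S x) ⬝ᵥ A.mulVec (restrictVec P x)
    set q := A.mulVec (restrictVec S x) ⬝ᵥ A.mulVec (restrictVec (T \ P) x)
    set a := √(∑ i ∈ S, x i ^ 2)
    calc √s * |p + q| ≤ √s * (|p| + |q|) := by gcongr; exact abs_add_le p q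
      _ = √s * |p| + √s * |q| := mul_add _ _ _
      _ ≤ √s * (δ * a * √(∑ i ∈ P, x i ^ 2)) + δ * a * (s * m + ∑ i ∈ T \ P, |x i|) := by
        gcongr
      _ = δ * a * (√s * √(∑ i ∈ P, x i ^ 2) + (s * m + ∑ i ∈ T \ P, |x i|)) := by ring
      _ ≤ δ * a * (s * M + ((∑ i ∈ P, |x i|) + ∑ i ∈ T \ P, |x i|)) := by gcongr
      _ = δ * a * (s * M + (∑ i ∈ T \ P, |x i| + ∑ i ∈ P, |x i|)) := by ring

lemma eq_zero_of_quadratic_le {a b δ : ℝ} (hδ₀ : 0 ≤ δ) (hδ : δ < √2 - 1)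
    (h : (1 - δ) * (a ^ 2 + b ^ 2) ≤ δ * (a * (a + b))) : a = 0 := by
  have hsqrt : (√2 : ℝ) ^ 2 = 2 := Real.sq_sqrt (by norm_num)
  have hsqrt₁ : (7 / 5 : ℝ) ≤ √2 := Real.le_sqrt_of_sq_le (by norm_num)
  have hquad : a * (a + b) ≤ √2 * (a ^ 2 + b ^ 2) := by
    calc a * (a + b) ≤ 7 / 5 * (a ^ 2 + b ^ 2) := by
          linarith [sq_nonneg (a - 5 / 4 * b), sq_nonneg b]
      _ ≤ √2 * (a ^ 2 + b ^ 2) := by gcongr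
  have hgap : 0 < 1 - δ - δ * √2 := by nlinarith
  have hsum : (1 - δ - δ * √2) * (a ^ 2 + b ^ 2) ≤ 0 := by
    linarith [mul_le_mul_of_nonneg_left hquad hδ₀]
  have hnonpos := nonpos_of_mul_nonpos_right hsum hgap
  exact pow_eq_zero_iff two_ne_zero |>.mp
    (le_antisymm (by linarith [sq_nonneg b]) (sq_nonneg a))

/-- A kernel vector whose `ℓ¹` mass is concentrated on at most `s` entries vanishes. -/
lemma RIPwith.eq_zero_of_mulVec_eq_zero {κ ι : Type*} [Fintype κ] [Fintype ι] [DecidableEq ι]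
    {A : Matrix κ ι ℝ} {s : ℕ} {δ : ℝ} (hδ₀ : 0 ≤ δ) (hδ : δ < √2 - 1)
    (hA : RIPwith A (2 * s) δ) {h : ι → ℝ} (hker : A.mulVec h = 0) {S : Finset ι}
    (hS : S.card ≤ s) (hcone : ∑ i ∈ Sᶜ, |h i| ≤ ∑ i ∈ S, |h i|) : h = 0 := by
  suffices hzero : ∑ i ∈ S, |h i| ≤ 0 by
    have htotal : ∑ i, |h i| = 0 := by
      refine le_antisymm ?_ (by positivity)
      rw [← Finset.sum_add_sum_compl S]
      linarith
    ext i
    simpa using (Finset.sum_eq_zero_iff_of_nonneg fun i _ => abs_nonneg (h i)).mp htotal i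
  rcases Nat.eq_zero_or_pos s with rfl | hs
  · simp [Finset.card_eq_zero.mp (Nat.le_zero.mp hS)]
  obtain ⟨P, hPS, hP, -, m, hm, hmP, hmR⟩ := exists_largest_entries h s Sᶜ
  set R := Sᶜ \ P with hR
  have hSP : Disjoint S P := disjoint_compl_right.mono_right hPS
  have hSR : Disjoint S R := disjoint_compl_right.mono_right Finset.sdiff_subset
  have hPR : Disjoint P R := Finset.disjoint_sdiff
  have hdecomp : restrictVec (S ∪ P) h + restrictVec R h = h := by
    rw [← restrictVec_union (Finset.disjoint_union_left.mpr ⟨hSR, hPR⟩), Finset.union_assoc, hR,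
      Finset.union_sdiff_of_subset hPS, Finset.union_compl]
    ext i
    simp [restrictVec]
  have hlower := (hA _ (isSparse_restrictVec
    ((Finset.card_union_le S P).trans (by omega) : (S ∪ P).card ≤ 2 * s) h)).1
  have hcross : l2sq (A.mulVec (restrictVec (S ∪ P) h)) =
      -(A.mulVec (restrictVec S h) ⬝ᵥ A.mulVec (restrictVec R h)) -
        A.mulVec (restrictVec P h) ⬝ᵥ A.mulVec (restrictVec R h) := by
    have himage : A.mulVec (restrictVec (S ∪ P) h) = -A.mulVec (restrictVec R h) := by
      rw [eq_neg_iff_add_eq_zero, ← Matrix.mulVec_add, hdecomp, hker]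
    rw [l2sq_eq_dotProduct]
    nth_rewrite 2 [himage]
    rw [restrictVec_union hSP, Matrix.mulVec_add, dotProduct_neg, add_dotProduct]
    ring
  rw [hcross, l2sq_restrictVec, Finset.sum_union hSP] at hlower
  have hcrossS := hA.sqrt_mul_abs_dotProduct_le hs hδ₀ h hS R hSR hm hmR
  have hcrossP := hA.sqrt_mul_abs_dotProduct_le hs hδ₀ h hP R hPR hm hmR
  have hmass : ∑ i ∈ R, |h i| + ∑ i ∈ P, |h i| = ∑ i ∈ Sᶜ, |h i| := Finset.sum_sdiff hPS
  have hcauchy := sq_sum_abs_le S hS h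
  have ha := Real.sq_sqrt (show 0 ≤ ∑ i ∈ S, h i ^ 2 by positivity)
  have hb := Real.sq_sqrt (show 0 ≤ ∑ i ∈ P, h i ^ 2 by positivity)
  have hr := Real.sq_sqrt (Nat.cast_nonneg (α := ℝ) s)
  have hr₀ : 0 < √(s : ℝ) := Real.sqrt_pos.mpr (by exact_mod_cast hs)
  rw [← ha, ← hb] at hlower
  rw [← ha, ← hr, ← mul_pow] at hcauchy
  set a := √(∑ i ∈ S, h i ^ 2)
  set b := √(∑ i ∈ P, h i ^ 2)
  have ha₀ : 0 ≤ a := Real.sqrt_nonneg _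
  have hb₀ : 0 ≤ b := Real.sqrt_nonneg _
  set r := √(s : ℝ)
  have hSle : ∑ i ∈ S, |h i| ≤ r * a := le_of_sq_le_sq hcauchy (by positivity)
  have hL : s * m + ∑ i ∈ R, |h i| ≤ r * a := by linarith
  set u := A.mulVec (restrictVec S h) ⬝ᵥ A.mulVec (restrictVec R h)
  set v := A.mulVec (restrictVec P h) ⬝ᵥ A.mulVec (restrictVec R h)
  have hu : |u| ≤ δ * a * a := by
    refine le_of_mul_le_mul_left ?_ hr₀
    calc r * |u| ≤ δ * a * (r * a) := hcrossS.trans (by gcongr)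
      _ = r * (δ * a * a) := by ring
  have hv : |v| ≤ δ * b * a := by
    refine le_of_mul_le_mul_left ?_ hr₀
    calc r * |v| ≤ δ * b * (r * a) := hcrossP.trans (by gcongr)
      _ = r * (δ * b * a) := by ring
  have hmain : (1 - δ) * (a ^ 2 + b ^ 2) ≤ δ * (a * (a + b)) := by
    linarith [neg_abs_le u, neg_abs_le v]
  have hazero := eq_zero_of_quadratic_le hδ₀ hδ hmain
  simpa [hazero] using hSle

/-- The error of a competitor with no larger `ℓ¹` norm is concentrated on the support. -/
lemma sum_compl_abs_sub_le {ι : Type*} [Fintype ι] [DecidableEq ι] {x y : ι → ℝ} {S : Finset ι}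
    (hy : ∀ i ∉ S, y i = 0) (hxy : l1norm x ≤ l1norm y) :
    ∑ i ∈ Sᶜ, |(x - y) i| ≤ ∑ i ∈ S, |(x - y) i| := by
  have hcompl : ∑ i ∈ Sᶜ, |(x - y) i| = ∑ i ∈ Sᶜ, |x i| :=
    Finset.sum_congr rfl fun i hi => by simp [hy i (Finset.mem_compl.mp hi)]
  have hycompl : ∑ i ∈ Sᶜ, |y i| = 0 :=
    Finset.sum_eq_zero fun i hi => by simp [hy i (Finset.mem_compl.mp hi)]
  have htri : ∑ i ∈ S, |y i| ≤ ∑ i ∈ S, |x i| + ∑ i ∈ S, |(x - y) i| := by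
    rw [← Finset.sum_add_distrib]
    refine Finset.sum_le_sum fun i _ => ?_
    have := abs_sub (x i) ((x - y) i)
    simpa using this
  rw [l1norm, l1norm, ← Finset.sum_add_sum_compl S, ← Finset.sum_add_sum_compl S (fun i => |y i|)]
    at hxy
  linarith

/-- If `2s < k` and the RIP constant of `A` of order `2s` is some
`δ < √2 - 1`, then every `s`-sparse `x̄` is the unique ℓ¹ minimizer subject to `Ax = Ax̄`. -/
theorem rip_implies_unique_sparse_recovery {k N : ℕ} (A : Matrix (Fin k) (Fin N) ℝ)
    (s : ℕ) (hks : 2 * s < k) (δ : ℝ) (hδpos : 0 < δ) (hδ : δ < Real.sqrt 2 - 1)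
    (hRIP : RIPwith A (2 * s) δ) :
    ∀ xbar : Fin N → ℝ, IsSparse s xbar →
      ∀ x : Fin N → ℝ, A.mulVec x = A.mulVec xbar → x ≠ xbar →
        l1norm xbar < l1norm x := by
  intro xbar ⟨S, hS, hxbar⟩ x hx hne
  by_contra! hle
  refine hne (sub_eq_zero.mp (hRIP.eq_zero_of_mulVec_eq_zero hδpos.le hδ ?_ hS
    (sum_compl_abs_sub_le hxbar hle)))
  rw [Matrix.mulVec_sub, hx, sub_self]
end

section
/- Let A = (A1, A2) with A1 ∈ ℝ^{k×(N−r)}, A2 ∈ ℝ^{k×r}, and r ≤ s. Then A satisfies the Null Space Property of order s−r for partially sparse recovery of size N−r if and only if for every x̄ = (x̄1, x̄2) with x̄1 ∈ ℝ^{N−r} an (s−r)-sparse vector and x̄2 ∈ ℝ^r, the problem of minimizing ‖x1‖₁ over (x1, x2) subject to A1x1 + A2x2 = A1x̄1 + A2x̄2 has a unique solution (x1, x2), and it is given by (x1, x2) = (x̄1, x̄2). -/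
open scoped BigOperators

theorem l1norm_neg {ι : Type*} [Fintype ι] (x : ι → ℝ) : l1norm (-x) = l1norm x := by
  simp [l1norm]

theorem l1norm_restrictVec_add_compl {ι : Type*} [Fintype ι] [DecidableEq ι]
    (S : Finset ι) (x : ι → ℝ) :
    l1norm (restrictVec S x) + l1norm (x - restrictVec S x) = l1norm x := by
  simp only [l1norm, ← Finset.sum_add_distrib]
  refine Finset.sum_congr rfl fun i _ => ?_
  by_cases h : i ∈ S <;> simp [restrictVec, h]

/-- Perturbing a vector supported in `S` by `v` changes the ℓ¹ norm by at least
`‖v‖₁ - 2 ‖v_S‖₁`. -/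
theorem l1norm_add_l1norm_sub_le {ι : Type*} [Fintype ι] [DecidableEq ι]
    {S : Finset ι} {x : ι → ℝ} (hx : ∀ i ∉ S, x i = 0) (y : ι → ℝ) :
    l1norm x + l1norm (y - x) ≤ l1norm y + 2 * l1norm (restrictVec S (y - x)) := by
  simp only [l1norm, Finset.mul_sum, ← Finset.sum_add_distrib]
  refine Finset.sum_le_sum fun i _ => ?_
  by_cases h : i ∈ S
  · have := abs_sub_abs_le_abs_sub (x i) (y i)
    rw [abs_sub_comm] at this
    simp only [restrictVec, h, if_true, Pi.sub_apply]
    linarith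
  · simp [restrictVec, h, hx i h]

/-- `A = (A1, A2)` satisfies the partial NSP of order `s - r` for
recovery of size `N - r` iff, for every `x̄ = (x̄1, x̄2)` with `x̄1` an `(s-r)`-sparse
vector, the problem `min ‖x1‖₁ s.t. A1 x1 + A2 x2 = A1 x̄1 + A2 x̄2` has the unique
solution `(x1, x2) = (x̄1, x̄2)`. -/
theorem partial_nsp_iff_unique_partial_recovery {k N r s : ℕ} (hr : r ≤ s) (hs : s ≤ N)
    (A1 : Matrix (Fin k) (Fin (N - r)) ℝ) (A2 : Matrix (Fin k) (Fin r) ℝ) :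
    PartialNSP A1 A2 (s - r) ↔
      ∀ (x1bar : Fin (N - r) → ℝ) (x2bar : Fin r → ℝ), IsSparse (s - r) x1bar →
        ∀ (x1 : Fin (N - r) → ℝ) (x2 : Fin r → ℝ),
          A1.mulVec x1 + A2.mulVec x2 = A1.mulVec x1bar + A2.mulVec x2bar →
          (x1, x2) ≠ (x1bar, x2bar) →
          l1norm x1bar < l1norm x1 := by
  constructor
  · rintro ⟨hinj, hnsp⟩ x1bar x2bar ⟨T, hT, hx1bar⟩ x1 x2 heq hne
    have hA : A1.mulVec (x1 - x1bar) = A2.mulVec (x2bar - x2) := by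
      rw [Matrix.mulVec_sub, Matrix.mulVec_sub, sub_eq_sub_iff_add_eq_add, heq, add_comm]
    have hv : x1 - x1bar ≠ 0 := by
      intro h
      rw [h, Matrix.mulVec_zero] at hA
      exact hne (Prod.ext (sub_eq_zero.mp h) (sub_eq_zero.mp (hinj _ hA.symm)).symm)
    obtain ⟨S, hTS, hS⟩ : ∃ S, T ⊆ S ∧ S.card = s - r :=
      Finset.exists_superset_card_eq hT (by simpa using Nat.sub_le_sub_right hs r)
    have hlt := hnsp _ hv ⟨_, hA⟩ S hS
    have hle := l1norm_add_l1norm_sub_le (fun i hi => hx1bar i fun h => hi (hTS h)) x1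
    linarith
  · intro h
    refine ⟨fun x2 hx2 => ?_, fun v1 hv1 ⟨v2, hv2⟩ S hS => ?_⟩
    · by_contra hne
      exact lt_irrefl _ (h 0 0 ⟨∅, by simp, by simp⟩ 0 x2 (by simp [hx2]) (by simp [hne]))
    · have hlt := h (-restrictVec S v1) v2 ⟨S, hS.le, fun i hi => by simp [restrictVec, hi]⟩
        (v1 - restrictVec S v1) 0
        (by rw [Matrix.mulVec_sub, Matrix.mulVec_neg, Matrix.mulVec_zero, hv2]; abel)
        (fun heq => hv1 (by simpa [sub_eq_add_neg] using congrArg Prod.fst heq))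
      rw [l1norm_neg] at hlt
      linarith [l1norm_restrictVec_add_compl S v1]
end

section
/- Let 0 < δ < √2 − 1, r ≤ s, and let c, d > 0 be constants such that: for every matrix M whose RIP constant of order 2(s−r) is at most δ, every vector z̄, every η ≥ 0, and every w with ‖Mz̄ − w‖₂ ≤ η, any minimizer z^# of ‖z‖₁ subject to ‖Mz − w‖₂ ≤ η satisfies ‖z^# − z̄‖₂ ≤ cη + d·σ_{s−r}(z̄)₁/√(s−r). Let A = (A1, A2) with A1 ∈ ℝ^{k×(N−r)}, A2 ∈ ℝ^{k×r}, A2 of full column rank, and suppose P·A1 has RIP constant of order 2(s−r) at most δ, where P = I − A2(A2ᵀA2)⁻¹A2ᵀ. Then for any x̄ = (x̄1, x̄2) ∈ ℝ^N, η ≥ 0, and y ∈ ℝ^k with ‖Ax̄ − y‖₂ ≤ η, any solution (x1*, x2*) of minimizing ‖x1‖₁ over (x1, x2) subject to ‖A1x1 + A2x2 − y‖₂ ≤ η satisfies ‖x1* − x̄1‖₂ ≤ cη + d·σ_{s−r}(x̄1)₁/√(s−r) and ‖x2* − x̄2‖₂ ≤ C2·(2η + C1·(cη + d·σ_{s−r}(x̄1)₁/√(s−r))),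 where C1 = ‖A1‖₂ is the operator 2-norm of A1 and C2 = ‖A2†‖₂ is the operator 2-norm of the pseudoinverse A2† = (A2ᵀA2)⁻¹A2ᵀ. -/
open scoped BigOperators

theorem l2norm_eq_norm {ι : Type*} [Fintype ι] (x : ι → ℝ) :
    l2norm x = ‖WithLp.toLp 2 x‖ := by
  simp [l2norm, EuclideanSpace.norm_eq]

theorem l2norm_nonneg {ι : Type*} [Fintype ι] (x : ι → ℝ) : 0 ≤ l2norm x :=
  Real.sqrt_nonneg _

theorem l2norm_sub_le {ι : Type*} [Fintype ι] (x y : ι → ℝ) :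
    l2norm (x - y) ≤ l2norm x + l2norm y := by
  simp only [l2norm_eq_norm, WithLp.toLp_sub]
  exact norm_sub_le _ _

theorem l2norm_smul {ι : Type*} [Fintype ι] (a : ℝ) (x : ι → ℝ) :
    l2norm (a • x) = |a| * l2norm x := by
  simp only [l2norm_eq_norm, WithLp.toLp_smul, norm_smul, Real.norm_eq_abs]

theorem l2norm_eq_zero {ι : Type*} [Fintype ι] {x : ι → ℝ} : l2norm x = 0 ↔ x = 0 := by
  simp [l2norm_eq_norm]

theorem bddAbove_l2norm_mulVec {a b : ℕ} (M : Matrix (Fin a) (Fin b) ℝ) :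
    BddAbove {t | ∃ x : Fin b → ℝ, l2norm x ≤ 1 ∧ t = l2norm (M.mulVec x)} := by
  refine ⟨‖(Matrix.toEuclideanLin M).toContinuousLinearMap‖, ?_⟩
  rintro t ⟨x, hx, rfl⟩
  rw [l2norm_eq_norm] at hx ⊢
  exact (Matrix.toEuclideanLin M).toContinuousLinearMap.unit_le_opNorm (WithLp.toLp 2 x) hx

theorem opNorm2_nonneg {a b : ℕ} (M : Matrix (Fin a) (Fin b) ℝ) : 0 ≤ opNorm2 M :=
  Real.sSup_nonneg (by rintro t ⟨x, -, rfl⟩; exact l2norm_nonneg _)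

theorem l2norm_mulVec_le {a b : ℕ} (M : Matrix (Fin a) (Fin b) ℝ) (x : Fin b → ℝ) :
    l2norm (M.mulVec x) ≤ opNorm2 M * l2norm x := by
  rcases eq_or_ne x 0 with rfl | hx
  · simp [l2norm]
  have hpos : 0 < l2norm x := (l2norm_nonneg x).lt_of_ne' (mt l2norm_eq_zero.mp hx)
  have h : l2norm (M.mulVec ((l2norm x)⁻¹ • x)) ≤ opNorm2 M :=
    le_csSup (bddAbove_l2norm_mulVec M)
      ⟨_, by rw [l2norm_smul, abs_of_pos (inv_pos.mpr hpos), inv_mul_cancel₀ hpos.ne'], rfl⟩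
  rwa [Matrix.mulVec_smul, l2norm_smul, abs_of_pos (inv_pos.mpr hpos), inv_mul_le_iff₀ hpos,
    mul_comm] at h

theorem isUnit_det_transpose_mul_self {k r : ℕ} {A : Matrix (Fin k) (Fin r) ℝ}
    (hA : ∀ x : Fin r → ℝ, A.mulVec x = 0 → x = 0) : IsUnit (A.transpose * A).det := by
  rw [← Matrix.isUnit_iff_isUnit_det, ← Matrix.mulVec_injective_iff_isUnit]
  refine (injective_iff_map_eq_zero (A.transpose * A).mulVecLin).mpr fun x hx => hA x ?_
  have hker : x ∈ (A.transpose * A).mulVecLin.ker := hx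
  rw [Matrix.ker_mulVecLin_transpose_mul_self] at hker
  exact hker

theorem transpose_mul_projPerp {k r : ℕ} {A : Matrix (Fin k) (Fin r) ℝ}
    (hA : IsUnit (A.transpose * A).det) : A.transpose * projPerp A = 0 := by
  rw [projPerp, Matrix.mul_sub, Matrix.mul_one, ← Matrix.mul_assoc, ← Matrix.mul_assoc,
    Matrix.mul_nonsing_inv _ hA, Matrix.one_mul, sub_self]

theorem projPerp_mul {k r : ℕ} {A : Matrix (Fin k) (Fin r) ℝ}
    (hA : IsUnit (A.transpose * A).det) : projPerp A * A = 0 := by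
  rw [projPerp, Matrix.sub_mul, Matrix.one_mul, Matrix.mul_assoc, Matrix.mul_assoc,
    Matrix.nonsing_inv_mul _ hA, Matrix.mul_one, sub_self]

theorem projPerp_mulVec {k r : ℕ} (A : Matrix (Fin k) (Fin r) ℝ) (v : Fin k → ℝ) :
    (projPerp A).mulVec v =
      v - A.mulVec (((A.transpose * A)⁻¹ * A.transpose).mulVec v) := by
  rw [projPerp, Matrix.sub_mulVec, Matrix.one_mulVec, Matrix.mulVec_mulVec, Matrix.mul_assoc]

theorem l2norm_projPerp_mulVec_le {k r : ℕ} {A : Matrix (Fin k) (Fin r) ℝ}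
    (hA : IsUnit (A.transpose * A).det) (v : Fin k → ℝ) :
    l2norm ((projPerp A).mulVec v) ≤ l2norm v := by
  set p := (projPerp A).mulVec v with hp
  set q := A.mulVec (((A.transpose * A)⁻¹ * A.transpose).mulVec v) with hq
  have hv : v = p + q := by rw [hp, projPerp_mulVec]; simp [hq]
  have horth : p ⬝ᵥ q = 0 := by
    rw [hq, Matrix.dotProduct_mulVec, ← Matrix.mulVec_transpose, hp, Matrix.mulVec_mulVec,
      transpose_mul_projPerp hA, Matrix.zero_mulVec, zero_dotProduct]
  refine Real.sqrt_le_sqrt ?_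
  have hsum : ∑ i, v i ^ 2 = ∑ i, p i ^ 2 + 2 * (p ⬝ᵥ q) + ∑ i, q i ^ 2 := by
    rw [dotProduct, Finset.mul_sum, ← Finset.sum_add_distrib, ← Finset.sum_add_distrib]
    refine Finset.sum_congr rfl fun i _ => ?_
    rw [hv, Pi.add_apply]
    ring
  have hq0 : 0 ≤ ∑ i, q i ^ 2 := Finset.sum_nonneg fun i _ => sq_nonneg _
  linarith

/-- Noisy partially sparse recovery: assuming the generic noisy recovery
guarantee with constants `c, d` for all matrices with RIP constant of order `2(s-r)` at
most `δ`, if `A2` has full column rank and `P·A1` has RIP constant of order `2(s-r)` at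
most `δ`, then any solution `(x1⋆, x2⋆)` of `min ‖x1‖₁ s.t. ‖A1x1 + A2x2 - y‖₂ ≤ η`
satisfies the stated error bounds, with `C1 = ‖A1‖₂` and `C2 = ‖A2†‖₂`. -/
theorem noisy_partial_recovery_error_bound {k N r s : ℕ} (hr : r ≤ s)
    (δ c d : ℝ) (hδ0 : 0 < δ) (hδ : δ < Real.sqrt 2 - 1) (hc : 0 < c) (hd : 0 < d)
    (hcd : ∀ (k' m : ℕ) (M : Matrix (Fin k') (Fin m) ℝ),
      RIPwith M (2 * (s - r)) δ →
        ∀ (zbar : Fin m → ℝ) (η : ℝ), 0 ≤ η → ∀ w : Fin k' → ℝ,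
          l2norm (M.mulVec zbar - w) ≤ η →
            ∀ zsharp : Fin m → ℝ,
              l2norm (M.mulVec zsharp - w) ≤ η →
              (∀ z : Fin m → ℝ, l2norm (M.mulVec z - w) ≤ η → l1norm zsharp ≤ l1norm z) →
              l2norm (zsharp - zbar) ≤
                c * η + d * sigma1 (s - r) zbar / Real.sqrt (s - r))
    (A1 : Matrix (Fin k) (Fin (N - r)) ℝ) (A2 : Matrix (Fin k) (Fin r) ℝ)
    (hA2 : ∀ x2 : Fin r → ℝ, A2.mulVec x2 = 0 → x2 = 0)
    (hRIP : RIPwith (projPerp A2 * A1) (2 * (s - r)) δ)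
    (x1bar : Fin (N - r) → ℝ) (x2bar : Fin r → ℝ) (η : ℝ) (hη : 0 ≤ η) (y : Fin k → ℝ)
    (hy : l2norm (A1.mulVec x1bar + A2.mulVec x2bar - y) ≤ η)
    (x1star : Fin (N - r) → ℝ) (x2star : Fin r → ℝ)
    (hfeas : l2norm (A1.mulVec x1star + A2.mulVec x2star - y) ≤ η)
    (hmin : ∀ (x1 : Fin (N - r) → ℝ) (x2 : Fin r → ℝ),
      l2norm (A1.mulVec x1 + A2.mulVec x2 - y) ≤ η → l1norm x1star ≤ l1norm x1) :
    l2norm (x1star - x1bar) ≤ c * η + d * sigma1 (s - r) x1bar / Real.sqrt (s - r) ∧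
    l2norm (x2star - x2bar) ≤
      opNorm2 ((A2.transpose * A2)⁻¹ * A2.transpose) *
        (2 * η + opNorm2 A1 *
          (c * η + d * sigma1 (s - r) x1bar / Real.sqrt (s - r))) := by
  have hG := isUnit_det_transpose_mul_self hA2
  have hproj : ∀ x1 x2, (projPerp A2).mulVec (A1.mulVec x1 + A2.mulVec x2 - y) =
      (projPerp A2 * A1).mulVec x1 - (projPerp A2).mulVec y := fun x1 x2 => by
    rw [Matrix.mulVec_sub, Matrix.mulVec_add, Matrix.mulVec_mulVec, Matrix.mulVec_mulVec,
      projPerp_mul hG, Matrix.zero_mulVec, add_zero]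
  have hcontr : ∀ x1 x2, l2norm (A1.mulVec x1 + A2.mulVec x2 - y) ≤ η →
      l2norm ((projPerp A2 * A1).mulVec x1 - (projPerp A2).mulVec y) ≤ η := fun x1 x2 h => by
    rw [← hproj x1 x2]
    exact (l2norm_projPerp_mulVec_le hG _).trans h
  have hfirst : l2norm (x1star - x1bar) ≤
      c * η + d * sigma1 (s - r) x1bar / Real.sqrt (s - r) := by
    refine hcd _ _ _ hRIP x1bar η hη _ (hcontr _ _ hy) x1star (hcontr _ _ hfeas)
      fun z hz => hmin z
        (-((A2.transpose * A2)⁻¹ * A2.transpose).mulVec (A1.mulVec z - y)) ?_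
    rw [← Matrix.mulVec_mulVec, ← Matrix.mulVec_sub, projPerp_mulVec] at hz
    rw [Matrix.mulVec_neg]
    convert hz using 2
    abel
  refine ⟨hfirst, ?_⟩
  have hleft : x2star - x2bar = ((A2.transpose * A2)⁻¹ * A2.transpose).mulVec
      (A2.mulVec (x2star - x2bar)) := by
    rw [Matrix.mulVec_mulVec, Matrix.mul_assoc, Matrix.nonsing_inv_mul _ hG, Matrix.one_mulVec]
  have hdiff : A2.mulVec (x2star - x2bar) =
      ((A1.mulVec x1star + A2.mulVec x2star - y) - (A1.mulVec x1bar + A2.mulVec x2bar - y)) -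
        A1.mulVec (x1star - x1bar) := by
    rw [Matrix.mulVec_sub, Matrix.mulVec_sub]
    abel
  have hres : l2norm (A2.mulVec (x2star - x2bar)) ≤ 2 * η + opNorm2 A1 *
      (c * η + d * sigma1 (s - r) x1bar / Real.sqrt (s - r)) := by
    rw [hdiff]
    refine (l2norm_sub_le _ _).trans (add_le_add ?_ ?_)
    · exact (l2norm_sub_le _ _).trans (by linarith)
    · exact (l2norm_mulVec_le _ _).trans
        (mul_le_mul_of_nonneg_left hfirst (opNorm2_nonneg _))
  rw [hleft]
  exact (l2norm_mulVec_le _ _).trans (mul_le_mul_of_nonneg_left hres (opNorm2_nonneg _))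
end
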